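/- Suppose every vertex of 𝒢 has at most 3 neighbours. Then there exists a polynomial P with real coefficients in the variables (x_ē)_{ē∈E}, of degree at most 1 in each variable, such that det(Id − Λ(x)) = P(x)² for every real weight vector x, where Λ(x) is the transition matrix with weights x and Id is the identity matrix indexed by directed edges. -/

import Mathlib

open scoped BigOperators

/-- The straight line segment drawn for an (unordered) edge, given the
positions of the vertices in the complex plane. -/
def segOf {α : Type*} (pos : α → ℂ) : Sym2 α → Set ℂ :=
  Sym2.lift ⟨fun u v => segment ℝ (pos u) (pos v), fun u v => segment_symm ℝ (pos u) (pos v)⟩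

/-- A finite graph embedded in the complex plane: vertices are distinct points
of `ℂ`, edges are unordered pairs of distinct vertices drawn as straight line
segments which pairwise intersect only at common endpoints, and no vertex lies
on an edge which does not contain it. -/
structure PlaneGraph where
  V : Type
  fintypeV : Fintype V
  decEqV : DecidableEq V
  pos : V → ℂ
  pos_inj : Function.Injective pos
  E : Finset (Sym2 V)
  not_diag : ∀ e ∈ E, ¬ e.IsDiag
  edges_meet : ∀ e₁ ∈ E, ∀ e₂ ∈ E, e₁ ≠ e₂ → ∀ p : ℂ,
    p ∈ segOf pos e₁ → p ∈ segOf pos e₂ → ∃ w : V, w ∈ e₁ ∧ w ∈ e₂ ∧ p = pos w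
  vertex_on_edge : ∀ e ∈ E, ∀ w : V, pos w ∈ segOf pos e → w ∈ e

attribute [instance] PlaneGraph.fintypeV PlaneGraph.decEqV

namespace PlaneGraph

variable (G : PlaneGraph)

/-- A directed edge: an ordered pair of vertices whose underlying
unordered pair is an edge of the graph. -/
abbrev DEdge : Type := {p : G.V × G.V // s(p.1, p.2) ∈ G.E}

/-- The reversal `-e` of a directed edge. -/
def rev (e : G.DEdge) : G.DEdge :=
  ⟨(e.val.2, e.val.1), by rw [Sym2.eq_swap]; exact e.property⟩

/-- The undirected version `ē` of a directed edge. -/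
def undir (e : G.DEdge) : Sym2 G.V := s(e.val.1, e.val.2)

/-- The turning angle `∠(e,g) = Arg((h_g - t_g)/(h_e - t_e)) ∈ (-π, π]`. -/
noncomputable def tangle (e g : G.DEdge) : ℝ :=
  Complex.arg ((G.pos g.val.2 - G.pos g.val.1) / (G.pos e.val.2 - G.pos e.val.1))

/-- The Kac–Ward transition matrix `Λ`, indexed by directed edges. -/
noncomputable def transMatrix (x : Sym2 G.V → ℝ) : Matrix G.DEdge G.DEdge ℂ :=
  fun e g =>
    if e.val.2 = g.val.1 ∧ g ≠ G.rev e then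
      (x (G.undir e) : ℂ) * Complex.exp (Complex.I / 2 * (G.tangle e g : ℂ))
    else 0

/-- A non-backtracking walk of length `n ≥ 1`, encoded as the list
`(w₁, …, w_{n+1})` of its `n+1` directed edges: consecutive edges are
incident head-to-tail and the walk never immediately reverses an edge. -/
def IsWalk (l : List G.DEdge) : Prop :=
  2 ≤ l.length ∧ l.Chain' (fun e g => e.val.2 = g.val.1 ∧ g ≠ G.rev e)

/-- The length `|w|` (number of steps) of a walk given as a list of edges. -/
def len (l : List G.DEdge) : ℕ := l.length - 1

/-- The weight `λ(w) = ∏_{i=1}^{n} Λ_{w_i, w_{i+1}}` of a walk. -/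
noncomputable def wlam (x : Sym2 G.V → ℝ) (l : List G.DEdge) : ℂ :=
  (List.zipWith (fun e g => G.transMatrix x e g) l l.tail).prod

/-- The edge weight `x(w) = ∏_{i=1}^{n} x_{\bar{w_i}}` of a walk
(the weight of the last edge is not included). -/
def wx (x : Sym2 G.V → ℝ) (l : List G.DEdge) : ℝ :=
  (l.dropLast.map (fun e => x (G.undir e))).prod

/-- The total turning angle `α(w) = Σ_{i=1}^{n} ∠(w_i, w_{i+1})` of a walk. -/
noncomputable def walpha (l : List G.DEdge) : ℝ :=
  (List.zipWith (fun e g => G.tangle e g) l l.tail).sum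

/-- The reversal `w⁻¹ = (-w_{n+1}, …, -w₁)` of a walk. -/
def wrev (l : List G.DEdge) : List G.DEdge := (l.map G.rev).reverse

/-- The concatenation `w ⊕ w'` of two walks, the first ending with the
directed edge with which the second starts. -/
def wconcat (l l' : List G.DEdge) : List G.DEdge := l ++ l'.tail

/-- A (rooted) loop: a walk of length at least `2` which starts and ends
with the same directed edge. -/
def IsLoop (l : List G.DEdge) : Prop :=
  G.IsWalk l ∧ 3 ≤ l.length ∧ l.head? = l.getLast?

/-- The number of times a loop `ℓ = (ℓ₁, …, ℓ_{n+1})` visits a directed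
edge `e`, i.e. the number of occurrences of `e` among `ℓ₁, …, ℓ_n`. -/
def visits (l : List G.DEdge) (e : G.DEdge) : ℕ := l.dropLast.count e

/-- A loop `ℓ` of length `n` is self-avoiding if each vertex appearing in it
appears in exactly two of the directed edges `ℓ₁, …, ℓ_n`. -/
def SelfAvoiding (l : List G.DEdge) : Prop :=
  G.IsLoop l ∧ ∀ v : G.V,
    l.dropLast.countP (fun e => decide (v = e.val.1 ∨ v = e.val.2)) ≠ 0 →
    l.dropLast.countP (fun e => decide (v = e.val.1 ∨ v = e.val.2)) = 2

/-- The degree of a vertex: the number of edges containing it. -/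
def degV (v : G.V) : ℕ := (G.E.filter (fun e => v ∈ e)).card

/-- A finite set of edges is even if every vertex belongs to an even number
of its edges. -/
def IsEvenSet (H : Finset (Sym2 G.V)) : Prop :=
  ∀ v : G.V, Even ((H.filter (fun e => v ∈ e)).card)

instance : DecidablePred G.IsEvenSet := fun H =>
  decidable_of_iff (∀ v : G.V, Even ((H.filter (fun e => v ∈ e)).card)) Iff.rfl

/-- The generating function `Z = Σ_{H even} ∏_{ē ∈ H} x_ē` of even
subgraphs. -/
def Z (x : Sym2 G.V → ℝ) : ℝ :=
  ∑ H ∈ G.E.powerset.filter G.IsEvenSet, ∏ e ∈ H, x e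

end PlaneGraph

section SkewSymmetric

open Matrix

lemma Equiv.Perm.exists_apply_eq_and_apply_eq {α : Type*} [DecidableEq α] {a b i j : α}
    (hab : a ≠ b) (hij : i ≠ j) : ∃ σ : Equiv.Perm α, σ a = i ∧ σ b = j := by
  have h : Equiv.swap a i b ≠ i := by
    intro h
    exact hab ((Equiv.swap a i).injective (h.trans (Equiv.swap_apply_left a i).symm)).symm
  refine ⟨(Equiv.swap a i).trans (Equiv.swap (Equiv.swap a i b) j), ?_, ?_⟩
  · simp [Equiv.swap_apply_of_ne_of_ne h.symm hij]
  · simp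

/-- The determinant of a skew-symmetric matrix over a field is a square. -/
lemma Matrix.isSquare_det_fin_of_transpose_eq_neg {F : Type*} [Field F] [NeZero (2 : F)] (n : ℕ)
    (M : Matrix (Fin n) (Fin n) F) (hM : Mᵀ = -M) : IsSquare M.det := by
  induction n using Nat.strong_induction_on with
  | _ n ih =>
    have hskew : ∀ i j, M j i = -M i j := fun i j => congrFun (congrFun hM i) j
    have hdiag : ∀ i, M i i = 0 := fun i => by
      have h : 2 * M i i = 0 := by linear_combination hskew i i
      exact (mul_eq_zero.mp h).resolve_left two_ne_zero
    rcases eq_or_ne M 0 with rfl | h0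
    · rcases n.eq_zero_or_pos with rfl | hn
      · simp
      · have := Fin.pos_iff_nonempty.mp hn
        simp
    obtain ⟨i, j, hij⟩ : ∃ i j, M i j ≠ 0 := by
      by_contra! h
      exact h0 (Matrix.ext h)
    have hne : i ≠ j := by
      rintro rfl
      exact hij (hdiag i)
    obtain ⟨m, rfl⟩ : ∃ m, n = 2 + m := by
      have := i.isLt
      have := j.isLt
      have := Fin.val_ne_of_ne hne
      exact ⟨n - 2, by omega⟩
    have h01 : (finSumFinEquiv (Sum.inl 0) : Fin (2 + m)) ≠ finSumFinEquiv (Sum.inl 1) := by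
      simp
    obtain ⟨σ, hσi, hσj⟩ := Equiv.Perm.exists_apply_eq_and_apply_eq h01 hne
    set e : Fin 2 ⊕ Fin m ≃ Fin (2 + m) := finSumFinEquiv.trans σ with he
    rw [← Matrix.det_submatrix_equiv_self e M, ← Matrix.fromBlocks_toBlocks (M.submatrix e e)]
    set N := M.submatrix e e with hN
    have hNskew : ∀ k l, N l k = -N k l := fun k l => hskew (e k) (e l)
    have hA : N.toBlocks₁₁.det = M i j * M i j := by
      have h0 : e (Sum.inl 0) = i := hσi
      have h1 : e (Sum.inl 1) = j := hσj
      simp [Matrix.det_fin_two, Matrix.toBlocks₁₁, hN, h0, h1, hdiag, hskew i j]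
    have hAunit : IsUnit N.toBlocks₁₁.det := by
      rw [hA]
      exact (mul_ne_zero hij hij).isUnit
    let _ := Matrix.invertibleOfIsUnitDet _ hAunit
    rw [Matrix.det_fromBlocks₁₁, hA, Matrix.invOf_eq_nonsing_inv]
    refine IsSquare.mul ⟨_, rfl⟩ (ih m (by omega) _ ?_)
    have hAt : N.toBlocks₁₁ᵀ = -N.toBlocks₁₁ := by
      ext k l; exact hNskew _ _
    have hBt : N.toBlocks₁₂ᵀ = -N.toBlocks₂₁ := by
      ext k l; exact hNskew _ _
    have hCt : N.toBlocks₂₁ᵀ = -N.toBlocks₁₂ := by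
      ext k l; exact hNskew _ _
    have hDt : N.toBlocks₂₂ᵀ = -N.toBlocks₂₂ := by
      ext k l; exact hNskew _ _
    have hAinv : (-N.toBlocks₁₁)⁻¹ = -N.toBlocks₁₁⁻¹ := by
      apply Matrix.inv_eq_right_inv
      rw [neg_mul_neg, Matrix.mul_nonsing_inv _ hAunit]
    rw [Matrix.transpose_sub, Matrix.transpose_mul, Matrix.transpose_mul,
      Matrix.transpose_nonsing_inv, hAt, hBt, hCt, hDt, hAinv]
    simp only [Matrix.neg_mul, Matrix.mul_neg, neg_neg, Matrix.mul_assoc, neg_sub]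
    abel

lemma IsIntegrallyClosed.isSquare_of_mul_sq {R : Type*} [CommRing R] [IsDomain R]
    [IsIntegrallyClosed R] {a b c : R} (hb : b ≠ 0) (h : a * b ^ 2 = c ^ 2) : IsSquare a := by
  obtain ⟨d, rfl⟩ : b ∣ c :=
    (IsIntegrallyClosed.pow_dvd_pow_iff two_ne_zero).mp ⟨a, by rw [← h, mul_comm]⟩
  exact ⟨d, mul_right_cancel₀ (pow_ne_zero 2 hb) (by rw [h]; ring)⟩

/-- The determinant of a skew-symmetric matrix over an integrally closed domain is a square. -/
lemma Matrix.isSquare_det_of_transpose_eq_neg {ι R : Type*} [Fintype ι] [DecidableEq ι]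
    [CommRing R] [IsDomain R] [IsIntegrallyClosed R] [NeZero (2 : R)]
    (M : Matrix ι ι R) (hM : Mᵀ = -M) : IsSquare M.det := by
  let F := FractionRing R
  let f : R →+* F := algebraMap R F
  have hf : Function.Injective f := IsFractionRing.injective R F
  have : NeZero (2 : F) := ⟨by
    rw [← map_ofNat f 2, Ne, map_eq_zero_iff f hf]
    exact two_ne_zero⟩
  let e := Fintype.equivFin ι
  obtain ⟨z, hz⟩ := Matrix.isSquare_det_fin_of_transpose_eq_neg _
    ((f.mapMatrix M).submatrix e.symm e.symm) (by
      ext i j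
      simpa using congrArg f (congrFun (congrFun hM (e.symm i)) (e.symm j)))
  rw [Matrix.det_submatrix_equiv_self, ← RingHom.map_det] at hz
  obtain ⟨c, b, hb, rfl⟩ := IsFractionRing.div_surjective (A := R) z
  have hb0 : b ≠ 0 := nonZeroDivisors.ne_zero hb
  have hfb : f b ≠ 0 := (map_ne_zero_iff f hf).mpr hb0
  refine IsIntegrallyClosed.isSquare_of_mul_sq (c := c) hb0 (hf ?_)
  rw [map_mul, map_pow, map_pow, hz]
  change f c / f b * (f c / f b) * f b ^ 2 = f c ^ 2
  rw [← sq, div_pow, div_mul_cancel₀ _ (pow_ne_zero 2 hfb)]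

/-- If `K` is a skew-symmetric complex structure commuting with the diagonal matrix `diagonal x`
and `S * K` is skew-symmetric, then `1 - diagonal x * S` has square determinant. -/
lemma Matrix.isSquare_det_one_sub_diagonal_mul {ι R : Type*} [Fintype ι] [DecidableEq ι]
    [CommRing R] [IsDomain R] [IsIntegrallyClosed R] [NeZero (2 : R)]
    (x : ι → R) (hx : ∀ i, x i ≠ 0) (S K : Matrix ι ι R) (hK : Kᵀ = -K) (hKK : K * K = -1)
    (hxK : Commute (diagonal x) K) (hSK : (S * K)ᵀ = -(S * K)) :
    IsSquare (1 - diagonal x * S).det := by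
  have hKx : (K * diagonal x)ᵀ = -(K * diagonal x) := by
    rw [transpose_mul, diagonal_transpose, hK, mul_neg, hxK.eq]
  obtain ⟨b, hb⟩ := isSquare_det_of_transpose_eq_neg (K * diagonal x) hKx
  obtain ⟨c, hc⟩ := isSquare_det_of_transpose_eq_neg
    (K * diagonal x - diagonal x * (S * K) * diagonal x) (by
      rw [transpose_sub, hKx, transpose_mul, transpose_mul, diagonal_transpose, hSK]
      simp only [neg_mul, mul_neg, Matrix.mul_assoc]
      abel)
  have hdetK : K.det ≠ 0 := by
    intro h
    have := congrArg det hKK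
    rw [det_mul, h, zero_mul] at this
    have hu : IsUnit (-1 : Matrix ι ι R).det := (isUnit_iff_isUnit_det _).mp isUnit_one.neg
    exact hu.ne_zero this.symm
  have hb0 : b ≠ 0 := by
    rintro rfl
    rw [mul_zero, det_mul, det_diagonal] at hb
    exact mul_ne_zero hdetK (Finset.prod_ne_zero_iff.mpr fun i _ => hx i) hb
  refine IsIntegrallyClosed.isSquare_of_mul_sq hb0 (c := c) ?_
  rw [sq, sq, ← hb, ← hc, ← det_mul]
  simp only [sub_mul, one_mul, Matrix.mul_assoc]

end SkewSymmetric

section HalfPhase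

/-- The square root of `z / ‖z‖` of argument `arg z / 2`. -/
noncomputable def halfPhase (z : ℂ) : ℂ := Complex.exp (Complex.I / 2 * (Complex.arg z : ℂ))

lemma halfPhase_ne_zero (z : ℂ) : halfPhase z ≠ 0 := Complex.exp_ne_zero _

lemma halfPhase_sq {z : ℂ} (hz : z ≠ 0) : halfPhase z ^ 2 = z / ‖z‖ := by
  have h : (‖z‖ : ℂ) ≠ 0 := by simpa using hz
  rw [eq_div_iff h, halfPhase, ← Complex.exp_nat_mul]
  conv_rhs => rw [← Complex.norm_mul_exp_arg_mul_I z]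
  rw [mul_comm]
  congr 2
  push_cast
  ring

lemma halfPhase_neg_sq {z : ℂ} (hz : z ≠ 0) : halfPhase (-z) ^ 2 = -halfPhase z ^ 2 := by
  rw [halfPhase_sq hz, halfPhase_sq (neg_ne_zero.mpr hz), norm_neg, neg_div]

lemma halfPhase_div_sq {z w : ℂ} (hz : z ≠ 0) (hw : w ≠ 0) :
    halfPhase (z / w) ^ 2 = halfPhase z ^ 2 / halfPhase w ^ 2 := by
  rw [halfPhase_sq hz, halfPhase_sq hw, halfPhase_sq (div_ne_zero hz hw), norm_div]
  push_cast
  rw [div_div_div_comm]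

lemma halfPhase_mul_halfPhase_inv {z : ℂ} (hz : Complex.arg z ≠ Real.pi) :
    halfPhase z * halfPhase z⁻¹ = 1 := by
  rw [halfPhase, halfPhase, ← Complex.exp_add, Complex.arg_inv, if_neg hz]
  push_cast
  ring_nf
  exact Complex.exp_zero

lemma Complex.ofReal_re_eq_of_sq_eq_one {z : ℂ} (hz : z ^ 2 = 1) : ((z.re : ℝ) : ℂ) = z := by
  rcases sq_eq_one_iff.mp hz with rfl | rfl <;> simp

lemma halfPhase_neg_div_sq {z : ℂ} (hz : z ≠ 0) :
    (halfPhase (-z) / (Complex.I * halfPhase z)) ^ 2 = 1 := by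
  have := halfPhase_ne_zero z
  rw [div_pow, mul_pow, halfPhase_neg_sq hz, Complex.I_sq]
  field_simp

lemma halfPhase_div_mul_div_sq {z w : ℂ} (hz : z ≠ 0) (hw : w ≠ 0) :
    (halfPhase (z / w) * halfPhase w / halfPhase z) ^ 2 = 1 := by
  have := halfPhase_ne_zero z
  have := halfPhase_ne_zero w
  rw [div_pow, mul_pow, halfPhase_div_sq hz hw]
  field_simp

end HalfPhase

namespace PlaneGraph

open Matrix

variable (G : PlaneGraph)

/-- The displacement from the tail to the head of a directed edge. -/
def disp (e : G.DEdge) : ℂ := G.pos e.val.2 - G.pos e.val.1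

@[simp] lemma rev_rev (e : G.DEdge) : G.rev (G.rev e) = e := rfl

@[simp] lemma undir_rev (e : G.DEdge) : G.undir (G.rev e) = G.undir e := Sym2.eq_swap

@[simp] lemma disp_rev (e : G.DEdge) : G.disp (G.rev e) = -G.disp e := (neg_sub _ _).symm

lemma fst_ne_snd (e : G.DEdge) : e.val.1 ≠ e.val.2 := fun h =>
  G.not_diag _ e.property (by simpa using h)

lemma disp_ne_zero (e : G.DEdge) : G.disp e ≠ 0 := fun h =>
  G.fst_ne_snd e (G.pos_inj (sub_eq_zero.mp h)).symm

/-- Two directed edges with the same head which point in the same direction coincide; here the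
second is assumed not to be longer than the first. -/
lemma eq_of_disp_eq_smul {e g : G.DEdge} (hh : e.val.2 = g.val.2) {r : ℝ} (hr0 : 0 ≤ r)
    (hr1 : r ≤ 1) (h : G.disp g = r * G.disp e) : e = g := by
  have hmem : G.pos g.val.1 ∈ segOf G.pos s(e.val.1, e.val.2) := by
    refine ⟨r, 1 - r, hr0, sub_nonneg.mpr hr1, by ring, ?_⟩
    simp only [disp, ← hh] at h
    simp only [Complex.real_smul]
    push_cast
    linear_combination h
  rcases Sym2.mem_iff.mp (G.vertex_on_edge _ e.property _ hmem) with h1 | h1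
  · exact Subtype.ext (Prod.ext h1.symm hh)
  · exact absurd (h1.trans hh) (G.fst_ne_snd g)

lemma tangle_ne_pi {e g : G.DEdge} (h : e.val.2 = g.val.1) (hne : g ≠ G.rev e) :
    G.tangle e g ≠ Real.pi := by
  intro hpi
  obtain ⟨hre, him⟩ := Complex.arg_eq_pi_iff.mp hpi
  set z := (G.pos g.val.2 - G.pos g.val.1) / (G.pos e.val.2 - G.pos e.val.1) with hz
  have hzre : z = (z.re : ℂ) := Complex.ext rfl (by simpa using him)
  have hdisp : G.disp (G.rev g) = ((-z.re : ℝ) : ℂ) * G.disp e := by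
    have : G.disp g = z * G.disp e := (div_mul_cancel₀ _ (G.disp_ne_zero e)).symm
    rw [disp_rev, this, Complex.ofReal_neg, ← hzre, neg_mul]
  have hne' : e ≠ G.rev g := fun he => hne (by rw [he, rev_rev])
  rcases le_total (-z.re) 1 with h1 | h1
  · exact hne' (G.eq_of_disp_eq_smul h (by linarith) h1 hdisp)
  · refine hne' (G.eq_of_disp_eq_smul (r := (-z.re)⁻¹) h.symm (inv_nonneg.mpr (by linarith))
      (inv_le_one_of_one_le₀ h1) ?_).symm
    rw [hdisp, ← mul_assoc, ← Complex.ofReal_mul, inv_mul_cancel₀ (by linarith),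
      Complex.ofReal_one, one_mul]

/-- The transition matrix with unit weights, gauged by the half-phases of the directed edges so
that its nonzero entries are signs. -/
noncomputable def turnSign : Matrix G.DEdge G.DEdge ℝ := fun e g =>
  if e.val.2 = g.val.1 ∧ g ≠ G.rev e then
    (halfPhase (G.disp g / G.disp e) * halfPhase (G.disp e) / halfPhase (G.disp g)).re
  else 0

/-- The sign comparing the half-phases of a directed edge and of its reversal. -/
noncomputable def revSign (e : G.DEdge) : ℝ :=
  (halfPhase (-G.disp e) / (Complex.I * halfPhase (G.disp e))).re

/-- The signed permutation matrix of the reversal of directed edges. -/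
noncomputable def revMatrix : Matrix G.DEdge G.DEdge ℝ := fun e g =>
  if g = G.rev e then G.revSign e else 0

lemma ofReal_revSign (e : G.DEdge) :
    (G.revSign e : ℂ) = halfPhase (-G.disp e) / (Complex.I * halfPhase (G.disp e)) :=
  Complex.ofReal_re_eq_of_sq_eq_one (halfPhase_neg_div_sq (G.disp_ne_zero e))

lemma revSign_mul_revSign_rev (e : G.DEdge) : G.revSign e * G.revSign (G.rev e) = -1 := by
  have h1 := halfPhase_ne_zero (G.disp e)
  have h2 := halfPhase_ne_zero (-G.disp e)
  apply Complex.ofReal_injective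
  push_cast
  rw [ofReal_revSign, ofReal_revSign, disp_rev, neg_neg]
  field_simp
  simp

lemma revSign_rev (e : G.DEdge) : G.revSign (G.rev e) = -G.revSign e := by
  have h1 : G.revSign e ^ 2 = 1 := by
    apply Complex.ofReal_injective
    push_cast
    rw [ofReal_revSign, halfPhase_neg_div_sq (G.disp_ne_zero e)]
  linear_combination -G.revSign (G.rev e) * h1 + G.revSign e * G.revSign_mul_revSign_rev e

lemma revMatrix_transpose : G.revMatrixᵀ = -G.revMatrix := by
  ext e g
  simp only [transpose_apply, Matrix.neg_apply, revMatrix]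
  by_cases h : g = G.rev e
  · rw [if_pos h, if_pos (by rw [h, rev_rev]), h, revSign_rev]
  · rw [if_neg h, if_neg fun h' => h (by rw [h', rev_rev]), neg_zero]

lemma mul_revMatrix_apply (M : Matrix G.DEdge G.DEdge ℝ) (e g : G.DEdge) :
    (M * G.revMatrix) e g = M e (G.rev g) * G.revSign (G.rev g) := by
  rw [mul_apply, Finset.sum_eq_single (G.rev g)]
  · simp [revMatrix]
  · intro f _ hf
    rw [revMatrix, if_neg fun h => hf (by rw [h, rev_rev]), mul_zero]
  · simp

lemma revMatrix_mul_self : G.revMatrix * G.revMatrix = -1 := by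
  ext e g
  rw [mul_revMatrix_apply, revMatrix, Matrix.neg_apply]
  by_cases h : e = g
  · subst h
    rw [if_pos rfl, one_apply_eq, revSign_mul_revSign_rev]
  · have h' : G.rev g ≠ G.rev e := fun h' => h (congrArg G.rev h').symm
    rw [if_neg h', one_apply_ne h]
    simp

lemma turnSign_mul_revMatrix_transpose :
    (G.turnSign * G.revMatrix)ᵀ = -(G.turnSign * G.revMatrix) := by
  ext g e
  rw [transpose_apply, Matrix.neg_apply, mul_revMatrix_apply, mul_revMatrix_apply, turnSign, turnSign]
  by_cases h : e.val.2 = g.val.2 ∧ e ≠ g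
  · have h1 : e.val.2 = (G.rev g).val.1 ∧ G.rev g ≠ G.rev e :=
      ⟨h.1, fun h' => h.2 (congrArg G.rev h').symm⟩
    have h2 : g.val.2 = (G.rev e).val.1 ∧ G.rev e ≠ G.rev g := ⟨h.1.symm, h1.2.symm⟩
    rw [if_pos h1, if_pos h2]
    have he := G.disp_ne_zero e
    have hg := G.disp_ne_zero g
    apply Complex.ofReal_injective
    push_cast
    rw [Complex.ofReal_re_eq_of_sq_eq_one
        (halfPhase_div_mul_div_sq (G.disp_ne_zero (G.rev g)) he),
      Complex.ofReal_re_eq_of_sq_eq_one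
        (halfPhase_div_mul_div_sq (G.disp_ne_zero (G.rev e)) hg),
      ofReal_revSign, ofReal_revSign, disp_rev, disp_rev, neg_neg, neg_neg]
    have hw : halfPhase (-G.disp g / G.disp e) * halfPhase (-G.disp e / G.disp g) = 1 := by
      have h3 := halfPhase_mul_halfPhase_inv (G.tangle_ne_pi h1.1 h1.2)
      change halfPhase (G.disp (G.rev g) / G.disp e) *
        halfPhase (G.disp (G.rev g) / G.disp e)⁻¹ = 1 at h3
      rwa [disp_rev, inv_div, div_neg, ← neg_div] at h3
    have hsq := halfPhase_div_sq (neg_ne_zero.mpr hg) he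
    have hc := halfPhase_neg_sq hg
    have hd := halfPhase_neg_sq he
    have ha0 := halfPhase_ne_zero (G.disp e)
    have hb0 := halfPhase_ne_zero (G.disp g)
    have hc0 := halfPhase_ne_zero (-G.disp g)
    have hd0 := halfPhase_ne_zero (-G.disp e)
    have hw0 := halfPhase_ne_zero (-G.disp g / G.disp e)
    have hw2 : halfPhase (-G.disp e / G.disp g) = (halfPhase (-G.disp g / G.disp e))⁻¹ :=
      eq_inv_of_mul_eq_one_right hw
    rw [hw2]
    generalize halfPhase (-G.disp g / G.disp e) = w at *
    generalize halfPhase (G.disp e) = a at *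
    generalize halfPhase (G.disp g) = b at *
    generalize halfPhase (-G.disp g) = c at *
    generalize halfPhase (-G.disp e) = d at *
    rw [eq_div_iff (pow_ne_zero 2 ha0)] at hsq
    have key : w ^ 2 * d ^ 2 = -c ^ 2 := by rw [hd, ← hsq]; ring
    field_simp
    linear_combination key
  · rw [if_neg, if_neg]
    · simp
    · exact fun h' => h ⟨h'.1.symm, fun h'' => h'.2 (congrArg G.rev h'')⟩
    · exact fun h' => h ⟨h'.1, fun h'' => h'.2 (congrArg G.rev h'').symm⟩

lemma transMatrix_eq (x : Sym2 G.V → ℝ) (e g : G.DEdge) :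
    G.transMatrix x e g = (halfPhase (G.disp e))⁻¹ *
      ((x (G.undir e) * G.turnSign e g : ℝ) : ℂ) * halfPhase (G.disp g) := by
  rw [transMatrix, turnSign]
  split_ifs
  · have he := halfPhase_ne_zero (G.disp e)
    have hg := halfPhase_ne_zero (G.disp g)
    rw [Complex.ofReal_mul, Complex.ofReal_re_eq_of_sq_eq_one
      (halfPhase_div_mul_div_sq (G.disp_ne_zero g) (G.disp_ne_zero e))]
    change _ * halfPhase (G.disp g / G.disp e) = _
    field_simp
  · simp

lemma det_one_sub_transMatrix (x : Sym2 G.V → ℝ) :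
    (1 - G.transMatrix x).det =
      (((1 - diagonal (fun e => x (G.undir e)) * G.turnSign).det : ℝ) : ℂ) := by
  have hu : ∀ e, halfPhase (G.disp e) ≠ 0 := fun e => halfPhase_ne_zero _
  set N : Matrix G.DEdge G.DEdge ℝ := 1 - diagonal (fun e => x (G.undir e)) * G.turnSign with hN
  have h : 1 - G.transMatrix x = diagonal (fun e => (halfPhase (G.disp e))⁻¹) *
      Complex.ofRealHom.mapMatrix N * diagonal (fun e => halfPhase (G.disp e)) := by
    ext e g
    rw [mul_diagonal, diagonal_mul, Matrix.sub_apply, transMatrix_eq, hN]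
    simp only [RingHom.mapMatrix_apply, map_apply, Matrix.sub_apply, diagonal_mul, map_sub, mul_sub,
      sub_mul]
    congr 1
    by_cases heg : e = g
    · subst heg
      simp [hu e]
    · simp [one_apply_ne heg]
  rw [h, det_mul, det_mul, det_diagonal, det_diagonal, mul_right_comm, ← Finset.prod_mul_distrib,
    Finset.prod_congr rfl fun e _ => inv_mul_cancel₀ (hu e), Finset.prod_const_one, one_mul,
    ← RingHom.map_det]
  rfl

/-- The gauged matrix `1 - Λ` with indeterminate weights. -/
noncomputable def polyMatrix :
    Matrix G.DEdge G.DEdge (MvPolynomial {e : Sym2 G.V // e ∈ G.E} ℝ) :=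
  1 - diagonal (fun e => MvPolynomial.X ⟨G.undir e, e.property⟩) *
    MvPolynomial.C.mapMatrix G.turnSign

lemma eval_det_polyMatrix (x : Sym2 G.V → ℝ) :
    MvPolynomial.eval (fun s => x s.val) G.polyMatrix.det =
      (1 - diagonal (fun e => x (G.undir e)) * G.turnSign).det := by
  rw [RingHom.map_det]
  congr 1
  ext e g
  rw [RingHom.mapMatrix_apply, map_apply, polyMatrix]
  simp only [RingHom.mapMatrix_apply, map_apply, Matrix.sub_apply, diagonal_mul, map_sub,
    map_mul, MvPolynomial.eval_X, MvPolynomial.eval_C, one_apply, apply_ite, map_one, map_zero]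

lemma isSquare_det_polyMatrix : IsSquare G.polyMatrix.det := by
  apply isSquare_det_one_sub_diagonal_mul _ (fun e => MvPolynomial.X_ne_zero _) _
    (MvPolynomial.C.mapMatrix G.revMatrix)
  · have h := congrArg
      (MvPolynomial.C (σ := {e : Sym2 G.V // e ∈ G.E})).mapMatrix G.revMatrix_transpose
    rw [map_neg] at h
    exact h
  · rw [← map_mul, revMatrix_mul_self, map_neg, map_one]
  · ext1 e g
    rw [diagonal_mul, mul_diagonal, RingHom.mapMatrix_apply, map_apply, revMatrix]
    split_ifs with h
    · subst h
      simp only [undir_rev]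
      ring
    · simp
  · rw [← map_mul]
    have h := congrArg
      (MvPolynomial.C (σ := {e : Sym2 G.V // e ∈ G.E})).mapMatrix G.turnSign_mul_revMatrix_transpose
    rw [map_neg] at h
    exact h

lemma card_filter_undir_eq_le (s : Sym2 G.V) :
    (Finset.univ.filter fun e : G.DEdge => G.undir e = s).card ≤ 2 := by
  induction s with
  | _ a b =>
    calc _ = ((Finset.univ.filter fun e : G.DEdge => G.undir e = s(a, b)).map
          (Function.Embedding.subtype _)).card := (Finset.card_map _).symm
      _ ≤ ({(a, b), (b, a)} : Finset (G.V × G.V)).card := by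
        refine Finset.card_le_card fun p hp => ?_
        obtain ⟨e, he, rfl⟩ := Finset.mem_map.mp hp
        have := Sym2.eq_iff.mp (Finset.mem_filter.mp he).2
        simpa [Prod.ext_iff] using this
      _ ≤ 2 := Finset.card_le_two

lemma degreeOf_polyMatrix_le (s : {e : Sym2 G.V // e ∈ G.E}) (e g : G.DEdge) :
    (G.polyMatrix e g).degreeOf s ≤ if G.undir e = s.val then 1 else 0 := by
  rw [polyMatrix, Matrix.sub_apply, diagonal_mul]
  refine (MvPolynomial.degreeOf_sub_le _ _ _).trans (max_le ?_ ?_)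
  · rw [one_apply]
    split_ifs <;> simp
  · refine (MvPolynomial.degreeOf_mul_C_le _ _ _).trans ?_
    rw [MvPolynomial.degreeOf_X]
    by_cases h : G.undir e = s.val
    · simp [h]
    · rw [if_neg fun h' => h (congrArg Subtype.val h').symm, if_neg h]

lemma degreeOf_det_polyMatrix_le (s : {e : Sym2 G.V // e ∈ G.E}) :
    G.polyMatrix.det.degreeOf s ≤ 2 := by
  rw [det_apply']
  refine (MvPolynomial.degreeOf_sum_le _ _ _).trans (Finset.sup_le fun σ _ => ?_)
  have hsign : ((σ.sign : ℤ) : MvPolynomial {e : Sym2 G.V // e ∈ G.E} ℝ) =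
      MvPolynomial.C ((σ.sign : ℤ) : ℝ) := (map_intCast _ _).symm
  rw [hsign]
  calc _ ≤ (∏ e, G.polyMatrix (σ e) e).degreeOf s := MvPolynomial.degreeOf_C_mul_le _ _ _
    _ ≤ ∑ e, (G.polyMatrix (σ e) e).degreeOf s := MvPolynomial.degreeOf_prod_le _ _ _
    _ ≤ ∑ e, if G.undir (σ e) = s.val then 1 else 0 :=
      Finset.sum_le_sum fun e _ => G.degreeOf_polyMatrix_le s _ _
    _ = ∑ e, if G.undir e = s.val then 1 else 0 :=
      Equiv.sum_comp σ fun e => if G.undir e = s.val then 1 else 0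
    _ = _ := (Finset.card_filter _ _).symm
    _ ≤ 2 := G.card_filter_undir_eq_le s

end PlaneGraph

/-- If every vertex of `𝒢` has at most three neighbours, then
`det(Id - Λ(x))` is the square of a polynomial with real coefficients in the
variables `(x_ē)_{ē ∈ E}` which has degree at most `1` in each variable. -/
theorem det_is_square_of_multilinear_poly (G : PlaneGraph)
    (hdeg : ∀ v : G.V, G.degV v ≤ 3) :
    ∃ P : MvPolynomial {e : Sym2 G.V // e ∈ G.E} ℝ,
      (∀ s : {e : Sym2 G.V // e ∈ G.E}, P.degreeOf s ≤ 1) ∧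
      ∀ x : Sym2 G.V → ℝ,
        Matrix.det (1 - G.transMatrix x) =
          ((MvPolynomial.eval (fun s => x s.val) P : ℝ) : ℂ) ^ 2 := by
  obtain ⟨P, hP⟩ := G.isSquare_det_polyMatrix
  refine ⟨P, fun s => ?_, fun x => ?_⟩
  · rcases eq_or_ne P 0 with rfl | h0
    · simp
    · have h := G.degreeOf_det_polyMatrix_le s
      rw [hP, MvPolynomial.degreeOf_mul_eq h0 h0] at h
      omega
  · rw [G.det_one_sub_transMatrix, ← G.eval_det_polyMatrix, hP, map_mul, Complex.ofReal_mul, sq]
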